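/- Let Y, N, G, R be random variables on a finite probability space taking values in finite types. Assume (i) R is conditionally independent of the pair (Y, N) given G (i.e., the Markov chain (Y,N) → G → R holds), and (ii) Y and N are independent. Then I(R; N) ≤ I(R; G) − I(R; Y). (This is the paper's Lemma 1, Nuisance Invariance, with R playing the role of the IB-refined graph G_IB(t), G the observed temporal graph, Y the label and N the task-irrelevant nuisance.) -/

import Mathlib

open scoped BigOperators

/-- Joint/marginal probability mass of a random variable `X` on a finite space with
probability mass function `p`. -/
noncomputable def massOf {Ω : Type*} [Fintype Ω] (p : Ω → ℝ)
    {A : Type*} [DecidableEq A] (X : Ω → A) (x : A) : ℝ :=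
  ∑ ω, if X ω = x then p ω else 0

/-- Joint probability mass of a pair of random variables. -/
noncomputable def massOf2 {Ω : Type*} [Fintype Ω] (p : Ω → ℝ)
    {A B : Type*} [DecidableEq A] [DecidableEq B] (X : Ω → A) (Z : Ω → B) (x : A) (z : B) : ℝ :=
  ∑ ω, if X ω = x ∧ Z ω = z then p ω else 0

/-- Joint probability mass of a triple of random variables. -/
noncomputable def massOf3 {Ω : Type*} [Fintype Ω] (p : Ω → ℝ)
    {A B C : Type*} [DecidableEq A] [DecidableEq B] [DecidableEq C]
    (X : Ω → A) (Z : Ω → B) (W : Ω → C) (x : A) (z : B) (w : C) : ℝ :=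
  ∑ ω, if X ω = x ∧ Z ω = z ∧ W ω = w then p ω else 0

/-- Shannon entropy `H(X)`. -/
noncomputable def entropy {Ω : Type*} [Fintype Ω] (p : Ω → ℝ)
    {A : Type*} [Fintype A] [DecidableEq A] (X : Ω → A) : ℝ :=
  -∑ x, massOf p X x * Real.log (massOf p X x)

/-- Conditional Shannon entropy `H(X|Z)`. -/
noncomputable def condEntropy {Ω : Type*} [Fintype Ω] (p : Ω → ℝ)
    {A B : Type*} [Fintype A] [DecidableEq A] [Fintype B] [DecidableEq B]
    (X : Ω → A) (Z : Ω → B) : ℝ :=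
  -∑ x, ∑ z, massOf2 p X Z x z * Real.log (massOf2 p X Z x z / massOf p Z z)

/-- Mutual information `I(X;Z)` (terms with zero probability vanish since they are
multiplied by the zero mass). -/
noncomputable def mutInfo {Ω : Type*} [Fintype Ω] (p : Ω → ℝ)
    {A B : Type*} [Fintype A] [DecidableEq A] [Fintype B] [DecidableEq B]
    (X : Ω → A) (Z : Ω → B) : ℝ :=
  ∑ x, ∑ z, massOf2 p X Z x z *
    Real.log (massOf2 p X Z x z / (massOf p X x * massOf p Z z))

/-- Conditional mutual information `I(X;Z|W)`, using
`p(x,z|w)/(p(x|w)p(z|w)) = p(x,z,w)p(w)/(p(x,w)p(z,w))`. -/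
noncomputable def condMutInfo {Ω : Type*} [Fintype Ω] (p : Ω → ℝ)
    {A B C : Type*} [Fintype A] [DecidableEq A] [Fintype B] [DecidableEq B]
    [Fintype C] [DecidableEq C] (X : Ω → A) (Z : Ω → B) (W : Ω → C) : ℝ :=
  ∑ x, ∑ z, ∑ w, massOf3 p X Z W x z w *
    Real.log ((massOf3 p X Z W x z w * massOf p W w) /
      (massOf2 p X W x w * massOf2 p Z W z w))

/-- `X` and `Z` are independent: `p(x,z) = p(x) p(z)`. -/
def IndepRV {Ω : Type*} [Fintype Ω] (p : Ω → ℝ)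
    {A B : Type*} [DecidableEq A] [DecidableEq B] (X : Ω → A) (Z : Ω → B) : Prop :=
  ∀ x z, massOf2 p X Z x z = massOf p X x * massOf p Z z

/-- `X` and `Z` are conditionally independent given `W`:
`p(x,z,w) p(w) = p(x,w) p(z,w)`. -/
def CondIndepRV {Ω : Type*} [Fintype Ω] (p : Ω → ℝ)
    {A B C : Type*} [DecidableEq A] [DecidableEq B] [DecidableEq C]
    (X : Ω → A) (Z : Ω → B) (W : Ω → C) : Prop :=
  ∀ x z w, massOf3 p X Z W x z w * massOf p W w = massOf2 p X W x w * massOf2 p Z W z w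

/-- Pushing an expectation forward along a random variable. -/
theorem sum_massOf_mul {Ω : Type*} [Fintype Ω] (p : Ω → ℝ) {A : Type*} [Fintype A]
    [DecidableEq A] (X : Ω → A) (f : A → ℝ) :
    ∑ x, massOf p X x * f x = ∑ ω, p ω * f (X ω) := by
  simp_rw [massOf, Finset.sum_mul]
  rw [Finset.sum_comm]
  simp [ite_mul]

theorem massOf2_eq_massOf {Ω : Type*} [Fintype Ω] (p : Ω → ℝ) {A B : Type*}
    [DecidableEq A] [DecidableEq B] (X : Ω → A) (Z : Ω → B) (x : A) (z : B) :
    massOf2 p X Z x z = massOf p (fun ω => (X ω, Z ω)) (x, z) := by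
  simp [massOf2, massOf]

theorem massOf3_eq_massOf {Ω : Type*} [Fintype Ω] (p : Ω → ℝ) {A B C : Type*}
    [DecidableEq A] [DecidableEq B] [DecidableEq C] (X : Ω → A) (Z : Ω → B) (W : Ω → C)
    (x : A) (z : B) (w : C) :
    massOf3 p X Z W x z w = massOf p (fun ω => (X ω, Z ω, W ω)) (x, z, w) := by
  simp [massOf3, massOf]

theorem massOf_nonneg {Ω : Type*} [Fintype Ω] {p : Ω → ℝ} (hp : ∀ ω, 0 ≤ p ω) {A : Type*}
    [DecidableEq A] (X : Ω → A) (x : A) : 0 ≤ massOf p X x :=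
  Finset.sum_nonneg fun ω _ => by split_ifs <;> simp [hp ω]

theorem massOf2_nonneg {Ω : Type*} [Fintype Ω] {p : Ω → ℝ} (hp : ∀ ω, 0 ≤ p ω)
    {A B : Type*} [DecidableEq A] [DecidableEq B] (X : Ω → A) (Z : Ω → B) (x : A) (z : B) :
    0 ≤ massOf2 p X Z x z := by
  rw [massOf2_eq_massOf]
  exact massOf_nonneg hp _ _

theorem massOf_apply_pos {Ω : Type*} [Fintype Ω] {p : Ω → ℝ} (hp : ∀ ω, 0 ≤ p ω) {A : Type*}
    [DecidableEq A] (X : Ω → A) {ω : Ω} (hω : 0 < p ω) : 0 < massOf p X (X ω) :=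
  Finset.sum_pos' (fun ω' _ => by split_ifs <;> simp [hp ω'])
    ⟨ω, Finset.mem_univ ω, by simpa using hω⟩

theorem massOf2_apply_pos {Ω : Type*} [Fintype Ω] {p : Ω → ℝ} (hp : ∀ ω, 0 ≤ p ω)
    {A B : Type*} [DecidableEq A] [DecidableEq B] (X : Ω → A) (Z : Ω → B) {ω : Ω}
    (hω : 0 < p ω) : 0 < massOf2 p X Z (X ω) (Z ω) := by
  rw [massOf2_eq_massOf]
  exact massOf_apply_pos hp (fun ω => (X ω, Z ω)) hω

theorem sum_massOf {Ω : Type*} [Fintype Ω] (p : Ω → ℝ) {A : Type*} [Fintype A]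
    [DecidableEq A] (X : Ω → A) : ∑ x, massOf p X x = ∑ ω, p ω := by
  simpa using sum_massOf_mul p X fun _ => 1

theorem sum_massOf2_right {Ω : Type*} [Fintype Ω] (p : Ω → ℝ) {A B : Type*}
    [DecidableEq A] [Fintype B] [DecidableEq B] (X : Ω → A) (Z : Ω → B) (x : A) :
    ∑ z, massOf2 p X Z x z = massOf p X x := by
  simp_rw [massOf2, massOf]
  rw [Finset.sum_comm]
  simp [ite_and]

theorem mutInfo_eq_sum {Ω : Type*} [Fintype Ω] (p : Ω → ℝ) {A B : Type*}
    [Fintype A] [DecidableEq A] [Fintype B] [DecidableEq B] (X : Ω → A) (Z : Ω → B) :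
    mutInfo p X Z = ∑ ω, p ω * Real.log (massOf2 p X Z (X ω) (Z ω) /
      (massOf p X (X ω) * massOf p Z (Z ω))) := by
  rw [← sum_massOf_mul p (fun ω => (X ω, Z ω)) fun a =>
    Real.log (massOf2 p X Z a.1 a.2 / (massOf p X a.1 * massOf p Z a.2)), Fintype.sum_prod_type]
  simp_rw [← massOf2_eq_massOf]
  rfl

/-- If `R` is conditionally independent of `(Y, N)` given `G`, the likelihood ratio
`p(r,y) p(r,n) p(g) / (p(r) p(y,n) p(r,g))` has expectation at most the total mass. -/
theorem sum_mul_likelihoodRatio_le {Ω : Type*} [Fintype Ω] {p : Ω → ℝ} (hp : ∀ ω, 0 ≤ p ω)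
    {𝒴 𝒩 𝒢 ℛ : Type*}
    [Fintype 𝒴] [DecidableEq 𝒴] [Fintype 𝒩] [DecidableEq 𝒩]
    [Fintype 𝒢] [DecidableEq 𝒢] [Fintype ℛ] [DecidableEq ℛ]
    {Y : Ω → 𝒴} {N : Ω → 𝒩} {G : Ω → 𝒢} {R : Ω → ℛ}
    (h : CondIndepRV p R (fun ω => (Y ω, N ω)) G) :
    ∑ ω, p ω * (massOf2 p R Y (R ω) (Y ω) * massOf2 p R N (R ω) (N ω) * massOf p G (G ω) /
      (massOf p R (R ω) * massOf2 p Y N (Y ω) (N ω) * massOf2 p R G (R ω) (G ω))) ≤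
      ∑ ω, p ω := by
  have hYNG (r : ℛ) (y : 𝒴) (n : 𝒩) (g : 𝒢) :
      massOf3 p R (fun ω => (Y ω, N ω)) G r (y, n) g *
        (massOf2 p R Y r y * massOf2 p R N r n * massOf p G g /
          (massOf p R r * massOf2 p Y N y n * massOf2 p R G r g)) ≤
      massOf2 p (fun ω => (Y ω, N ω)) G (y, n) g *
        (massOf2 p R Y r y * massOf2 p R N r n / (massOf p R r * massOf2 p Y N y n)) := by
    have hRY := massOf2_nonneg hp R Y r y
    have hRN := massOf2_nonneg hp R N r n
    have hR := massOf_nonneg hp R r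
    have hYN := massOf2_nonneg hp Y N y n
    have hG := massOf2_nonneg hp (fun ω => (Y ω, N ω)) G (y, n) g
    rcases (massOf2_nonneg hp R G r g).eq_or_lt with h0 | h0
    · rw [← h0, mul_zero, div_zero, mul_zero]
      positivity
    · refine le_of_eq ?_
      calc _ = (massOf3 p R (fun ω => (Y ω, N ω)) G r (y, n) g * massOf p G g) /
            massOf2 p R G r g * (massOf2 p R Y r y * massOf2 p R N r n /
              (massOf p R r * massOf2 p Y N y n)) := by
            simp only [div_eq_mul_inv, mul_inv]
            ring
        _ = _ := by rw [h, mul_div_cancel_left₀ _ h0.ne']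
  have hYN (r : ℛ) (y : 𝒴) (n : 𝒩) :
      massOf2 p Y N y n *
        (massOf2 p R Y r y * massOf2 p R N r n / (massOf p R r * massOf2 p Y N y n)) ≤
      massOf2 p R Y r y * (massOf2 p R N r n / massOf p R r) := by
    have hRY := massOf2_nonneg hp R Y r y
    have hRN := massOf2_nonneg hp R N r n
    have hR := massOf_nonneg hp R r
    rcases (massOf2_nonneg hp Y N y n).eq_or_lt with h0 | h0
    · rw [← h0, zero_mul]
      positivity
    · refine le_of_eq ?_
      rw [← mul_div_assoc, mul_comm (massOf p R r), mul_div_mul_left _ _ h0.ne', mul_div_assoc]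
  have hRN (r : ℛ) (n : 𝒩) :
      massOf p R r * (massOf2 p R N r n / massOf p R r) ≤ massOf2 p R N r n := by
    rcases eq_or_ne (massOf p R r) 0 with h0 | h0
    · rw [h0, zero_mul]
      exact massOf2_nonneg hp R N r n
    · rw [mul_div_cancel₀ _ h0]
  rw [← sum_massOf_mul p (fun ω => (R ω, (Y ω, N ω), G ω)) fun a =>
    massOf2 p R Y a.1 a.2.1.1 * massOf2 p R N a.1 a.2.1.2 * massOf p G a.2.2 /
      (massOf p R a.1 * massOf2 p Y N a.2.1.1 a.2.1.2 * massOf2 p R G a.1 a.2.2)]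
  simp_rw [Fintype.sum_prod_type, ← massOf3_eq_massOf]
  calc _ ≤ ∑ r, ∑ y, ∑ n, ∑ g, massOf2 p (fun ω => (Y ω, N ω)) G (y, n) g *
          (massOf2 p R Y r y * massOf2 p R N r n / (massOf p R r * massOf2 p Y N y n)) := by
        exact Finset.sum_le_sum fun r _ => Finset.sum_le_sum fun y _ =>
          Finset.sum_le_sum fun n _ => Finset.sum_le_sum fun g _ => hYNG r y n g
    _ = ∑ r, ∑ y, ∑ n, massOf2 p Y N y n *
          (massOf2 p R Y r y * massOf2 p R N r n / (massOf p R r * massOf2 p Y N y n)) := by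
        simp_rw [← Finset.sum_mul, sum_massOf2_right, massOf2_eq_massOf p Y N]
    _ ≤ ∑ r, ∑ y, ∑ n, massOf2 p R Y r y * (massOf2 p R N r n / massOf p R r) := by
        exact Finset.sum_le_sum fun r _ => Finset.sum_le_sum fun y _ =>
          Finset.sum_le_sum fun n _ => hYN r y n
    _ = ∑ r, ∑ n, massOf p R r * (massOf2 p R N r n / massOf p R r) := by
        refine Finset.sum_congr rfl fun r _ => ?_
        rw [Finset.sum_comm]
        simp_rw [← Finset.sum_mul, sum_massOf2_right]
    _ ≤ ∑ r, ∑ n, massOf2 p R N r n := by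
        exact Finset.sum_le_sum fun r _ => Finset.sum_le_sum fun n _ => hRN r n
    _ = ∑ ω, p ω := by simp_rw [sum_massOf2_right, sum_massOf]

/-- **Lemma 1 (Nuisance Invariance).** If the Markov chain `(Y,N) → G → R` holds
(`R` conditionally independent of `(Y,N)` given `G`) and the nuisance `N` is independent
of the label `Y`, then `I(R;N) ≤ I(R;G) − I(R;Y)`. -/
theorem nuisance_invariance
    {Ω : Type*} [Fintype Ω] (p : Ω → ℝ)
    (hp0 : ∀ ω, 0 ≤ p ω) (hp1 : ∑ ω, p ω = 1)
    {𝒴 𝒩 𝒢 ℛ : Type*}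
    [Fintype 𝒴] [DecidableEq 𝒴] [Fintype 𝒩] [DecidableEq 𝒩]
    [Fintype 𝒢] [DecidableEq 𝒢] [Fintype ℛ] [DecidableEq ℛ]
    (Y : Ω → 𝒴) (N : Ω → 𝒩) (G : Ω → 𝒢) (R : Ω → ℛ)
    (hMarkov : CondIndepRV p R (fun ω => (Y ω, N ω)) G)
    (hIndep : IndepRV p Y N) :
    mutInfo p R N ≤ mutInfo p R G - mutInfo p R Y := by
  simp only [mutInfo_eq_sum, ← Finset.sum_sub_distrib]
  have hratio := sum_mul_likelihoodRatio_le hp0 hMarkov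
  rw [← sub_nonneg, ← Finset.sum_sub_distrib] at hratio ⊢
  refine hratio.trans (Finset.sum_le_sum fun ω _ => ?_)
  rcases (hp0 ω).eq_or_lt with h0 | hω
  · simp [← h0]
  have hR := massOf_apply_pos hp0 R hω
  have hY := massOf_apply_pos hp0 Y hω
  have hN := massOf_apply_pos hp0 N hω
  have hG := massOf_apply_pos hp0 G hω
  have hRY := massOf2_apply_pos hp0 R Y hω
  have hRN := massOf2_apply_pos hp0 R N hω
  have hRG := massOf2_apply_pos hp0 R G hω
  rw [hIndep]
  have hlog := mul_le_mul_of_nonneg_left (Real.log_le_sub_one_of_pos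
    (x := massOf2 p R Y (R ω) (Y ω) * massOf2 p R N (R ω) (N ω) * massOf p G (G ω) /
      (massOf p R (R ω) * (massOf p Y (Y ω) * massOf p N (N ω)) * massOf2 p R G (R ω) (G ω)))
    (by positivity)) hω.le
  rw [Real.log_div (by positivity) (by positivity), Real.log_mul (by positivity) (by positivity),
    Real.log_mul (by positivity) (by positivity), Real.log_mul (by positivity) (by positivity),
    Real.log_mul (by positivity) (by positivity), Real.log_mul (by positivity) (by positivity)]
    at hlog
  rw [Real.log_div (by positivity) (by positivity), Real.log_div (by positivity) (by positivity),
    Real.log_div (by positivity) (by positivity), Real.log_mul (by positivity) (by positivity),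
    Real.log_mul (by positivity) (by positivity), Real.log_mul (by positivity) (by positivity)]
  linarith
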